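/- Let d ≥ 1 and let ξ ∈ L^∞(ℝ^d) satisfy ‖ξ‖_{L^∞} < 1. Define the bounded linear operator A on L²(ℝ^d; ℝ^d) by A U := Π(ξ · (Π U)), where ξ · denotes pointwise scalar multiplication. Then the operator norm of A is at most ‖ξ‖_{L^∞}, the series V := Σ_{n=0}^∞ (−1)^n A^n (Π W) converges in L²(ℝ^d; ℝ^d) for every W ∈ L²(ℝ^d; ℝ^d), and its sum V belongs to G and satisfies ∇·((1+ξ)V) = ∇·W in the distributional sense. -/

import Mathlib

open MeasureTheory RealInnerProductSpace

noncomputable section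

/-- Euclidean space `ℝ^d`. -/
abbrev EucSp (d : ℕ) := EuclideanSpace ℝ (Fin d)

/-- The space `L²(ℝ^d; ℝ^d)` of square-integrable vector fields. -/
abbrev L2V (d : ℕ) := Lp (EucSp d) 2 (volume : Measure (EucSp d))

/-- Smooth compactly supported test functions. -/
def IsTest {d : ℕ} (φ : EucSp d → ℝ) : Prop := ContDiff ℝ (⊤ : ℕ∞) φ ∧ HasCompactSupport φ

/-- The set of (L²-classes of) gradients of smooth compactly supported functions;
its closure is the space `G` of gradient vector fields. -/
def gradSet (d : ℕ) : Set (L2V d) :=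
  {f | ∃ φ : EucSp d → ℝ, IsTest φ ∧ (⇑f) =ᵐ[volume] gradient φ}

/-- `∇·((1+ξ)V) = ∇·W` in the distributional sense. -/
def DivEq {d : ℕ} (ξ : Lp ℝ ⊤ (volume : Measure (EucSp d))) (V W : L2V d) : Prop :=
  ∀ φ : EucSp d → ℝ, IsTest φ →
    ∫ x, (1 + ξ x) * ⟪V x, gradient φ x⟫ = ∫ x, ⟪W x, gradient φ x⟫

set_option maxHeartbeats 2000000

theorem grad_memLp {d : ℕ} (φ : EucSp d → ℝ) (h : IsTest φ) :
    MemLp (gradient φ) 2 (volume : Measure (EucSp d)) := by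
  have hc : Continuous (gradient φ) := by
    unfold gradient
    exact (InnerProductSpace.toDual ℝ (EucSp d)).symm.continuous.comp
      (h.1.continuous_fderiv (by simp))
  have hs : HasCompactSupport (gradient φ) := by
    have := (h.2.fderiv (𝕜 := ℝ)).comp_left
      (g := (InnerProductSpace.toDual ℝ (EucSp d)).symm) (map_zero _)
    exact this
  exact hc.memLp_of_hasCompactSupport hs

/-- Neumann-series construction of `𝔔[ξ]` : with `P` the orthogonal projection of `L²`
onto the space `G` of gradient vector fields, `M` the pointwise multiplication by `ξ`,
and `A := P ∘ M ∘ P` (i.e. `A U = Π(ξ·(Π U))`), the operator norm of `A` is at most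
`‖ξ‖_{L^∞}`, the series `Σ (−1)^n Aⁿ (Π W)` converges in `L²`, its sum `V` belongs to `G`
and satisfies `∇·((1+ξ)V) = ∇·W` in the distributional sense. -/
theorem neumann_series_solution (d : ℕ) (hd : 1 ≤ d)
    (ξ : Lp ℝ ⊤ (volume : Measure (EucSp d))) (hξ : ‖ξ‖ < 1)
    -- `P` is the orthogonal projection onto `G = closure (gradSet d)`:
    (P : L2V d →L[ℝ] L2V d)
    (hPmem : ∀ U : L2V d, P U ∈ closure (gradSet d))
    (hPorth : ∀ U : L2V d, ∀ g ∈ closure (gradSet d), ⟪U - P U, g⟫ = 0)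
    -- `M` is the pointwise scalar multiplication by `ξ`:
    (M : L2V d →L[ℝ] L2V d)
    (hM : ∀ U : L2V d, (⇑(M U)) =ᵐ[volume] fun x => ξ x • (U x))
    -- the operator `A U := Π(ξ·(Π U))`:
    (A : L2V d →L[ℝ] L2V d) (hA : A = P ∘L M ∘L P) :
    ‖A‖ ≤ ‖ξ‖ ∧
    ∀ W : L2V d,
      Summable (fun n : ℕ => ((-1 : ℝ) ^ n) • ((A ^ n) (P W))) ∧
      (∑' n : ℕ, ((-1 : ℝ) ^ n) • ((A ^ n) (P W))) ∈ closure (gradSet d) ∧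
      DivEq ξ (∑' n : ℕ, ((-1 : ℝ) ^ n) • ((A ^ n) (P W))) W := by
  have hPfix : ∀ g ∈ closure (gradSet d), P g = g := by
    intro g hg
    have h1 := hPorth g g hg
    have h2 := hPorth g (P g) (hPmem g)
    have h3 : ⟪g - P g, g - P g⟫ = 0 := by rw [inner_sub_right, h1, h2, sub_zero]
    exact (sub_eq_zero.1 (inner_self_eq_zero.1 h3)).symm
  have hPn : ∀ U, ‖P U‖ ≤ ‖U‖ := by
    intro U
    have h2 := hPorth U (P U) (hPmem U)
    rw [inner_sub_left, real_inner_self_eq_norm_sq] at h2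
    have h3 := real_inner_le_norm U (P U)
    by_contra hlt
    push Not at hlt
    nlinarith [norm_nonneg U, norm_nonneg (P U)]
  have hMn : ∀ U, ‖M U‖ ≤ ‖ξ‖ * ‖U‖ := by
    intro U
    have h : M U = (ξ • U : L2V d) := by
      apply Lp.ext
      filter_upwards [hM U, Lp.coeFn_lpSMul (r := 2) ξ U] with x h1 h2
      rw [h1, h2]; rfl
    rw [h]
    exact Lp.norm_smul_le ξ U
  have hAn : ‖A‖ ≤ ‖ξ‖ := by
    refine A.opNorm_le_bound (norm_nonneg _) fun U => ?_
    rw [hA]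
    calc ‖P (M (P U))‖ ≤ ‖M (P U)‖ := hPn _
      _ ≤ ‖ξ‖ * ‖P U‖ := hMn _
      _ ≤ ‖ξ‖ * ‖U‖ := by gcongr; exact hPn U
  refine ⟨hAn, fun W => ?_⟩
  have hAa : ∀ U, A U = P (M (P U)) := fun U => by rw [hA]; rfl
  have hAn1 : ∀ U, ‖A U‖ ≤ ‖ξ‖ * ‖U‖ := fun U => A.le_of_opNorm_le hAn U
  have hpow : ∀ n U, ‖(A ^ n) U‖ ≤ ‖ξ‖ ^ n * ‖U‖ := by
    intro n U
    induction n with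
    | zero => simp
    | succ n ih =>
      rw [pow_succ' A]
      calc ‖A ((A ^ n) U)‖ ≤ ‖ξ‖ * ‖(A ^ n) U‖ := hAn1 _
        _ ≤ ‖ξ‖ * (‖ξ‖ ^ n * ‖U‖) := by gcongr
        _ = _ := by ring
  have hsum : Summable (fun n : ℕ => ((-1 : ℝ) ^ n) • ((A ^ n) (P W))) := by
    refine Summable.of_norm_bounded
      ((summable_geometric_of_lt_one (norm_nonneg ξ) hξ).mul_right ‖P W‖) fun n => ?_
    rw [norm_smul]
    simpa using hpow n (P W)
  have hV1 : (∑' n : ℕ, ((-1 : ℝ) ^ n) • ((A ^ n) (P W))) =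
      P W - A (∑' n : ℕ, ((-1 : ℝ) ^ n) • ((A ^ n) (P W))) := by
    conv_lhs => rw [hsum.tsum_eq_zero_add]
    rw [A.map_tsum hsum, sub_eq_add_neg, ← tsum_neg]
    congr 1
    · simp
    · refine tsum_congr fun n => ?_
      rw [map_smul, pow_succ' A, pow_succ (-1 : ℝ), mul_neg_one, neg_smul]
      rfl
  refine ⟨hsum, ?_⟩
  generalize (∑' n : ℕ, ((-1 : ℝ) ^ n) • ((A ^ n) (P W))) = V at hV1
  have hPV : P V = V := by
    rw [hV1, map_sub, hAa, hPfix _ (hPmem W), hPfix _ (hPmem _)]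
  refine ⟨hPV ▸ hPmem V, ?_⟩
  intro φ hφ
  have hm := grad_memLp φ hφ
  have hg : hm.toLp ∈ closure (gradSet d) := subset_closure ⟨φ, hφ, hm.coeFn_toLp⟩
  have e1 := hPorth W _ hg
  have e2 := hPorth (M V) _ hg
  have e3 : ⟪V + M V, hm.toLp⟫ = ⟪W, hm.toLp⟫ := by
    have h4 : V = P W - P (M V) := by
      conv_lhs => rw [hV1, hAa, hPV]
    rw [inner_sub_left] at e1 e2
    rw [inner_add_left]
    have h5 : ⟪V, hm.toLp⟫ = ⟪P W, hm.toLp⟫ - ⟪P (M V), hm.toLp⟫ := by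
      rw [← inner_sub_left, ← h4]
    linarith
  rw [L2.inner_def, L2.inner_def] at e3
  have l1 : ∫ x, (1 + ξ x) * ⟪V x, gradient φ x⟫ = ∫ x, ⟪(V + M V) x, (hm.toLp (gradient φ)) x⟫ := by
    apply integral_congr_ae
    filter_upwards [hM V, hm.coeFn_toLp, Lp.coeFn_add V (M V)] with x h1 h2 h3
    rw [h2, h3, Pi.add_apply, h1, inner_add_left, real_inner_smul_left]
    ring
  have l2 : ∫ x, ⟪W x, gradient φ x⟫ = ∫ x, ⟪W x, (hm.toLp (gradient φ)) x⟫ := by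
    apply integral_congr_ae
    filter_upwards [hm.coeFn_toLp] with x h2
    rw [h2]
  rw [l1, l2, e3]
end
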